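/- arXiv:2007.13468 — 4 statements merged into one kernel-verified Lean document; each statement's English description precedes it below -/
import Mathlib

section
/- Let N ≥ 1 be an integer, t₀ a real number, ε > 0, and let A : ℝ → M_N(ℂ) be a family of complex N×N matrices such that A(t) is Hermitian for every t and the real and imaginary parts of each entry of A(t) are real-analytic functions of t on the interval (t₀ − 2ε, t₀ + 2ε). Since A(t) is Hermitian, f(t) = det A(t) is real for each t. Suppose that f(t₀) = 0, that f′(t₀) ≠ 0 (so t₀ is a simple root of f), and that f(t) ≠ 0 for every t ∈ (t₀ − 2ε, t₀ + 2ε) with t ≠ t₀. Let s₀, s₊, s₋ denote the signature of A(t) at t = t₀, t = t₀ + ε, t = t₀ − ε respectively. Then |s₊ − s₋| = 2, s₀ = (s₊ + s₋)/2, and the nullity of A(t₀) is 1 (equivalently, the rank of A(t₀) is N − 1). -/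
open scoped Classical

/-- The signature of a Hermitian matrix: the number of positive eigenvalues minus
the number of negative eigenvalues (with multiplicity). -/
noncomputable def hermSignature {N : ℕ} {A : Matrix (Fin N) (Fin N) ℂ}
    (hA : A.IsHermitian) : ℤ :=
  ((Finset.univ.filter fun i => 0 < hA.eigenvalues i).card : ℤ) -
  ((Finset.univ.filter fun i => hA.eigenvalues i < 0).card : ℤ)

/-- The nullity of a complex matrix: the dimension of its kernel. -/
noncomputable def nullity {N : ℕ} (A : Matrix (Fin N) (Fin N) ℂ) : ℕ :=
  Module.finrank ℂ (LinearMap.ker (Matrix.toLin' A))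

open Matrix Filter Topology

/-- The number of eigenvalues of a Hermitian matrix whose product with the real number `σ`
is positive. For `σ = 1` and `σ = -1` these are the positive and the negative index of inertia. -/
noncomputable def inertiaIndex {N : ℕ} {A : Matrix (Fin N) (Fin N) ℂ} (σ : ℝ)
    (hA : A.IsHermitian) : ℕ :=
  (Finset.univ.filter fun i => 0 < σ * hA.eigenvalues i).card

theorem hermSignature_eq_inertiaIndex_sub {N : ℕ} {A : Matrix (Fin N) (Fin N) ℂ}
    (hA : A.IsHermitian) :
    hermSignature hA = (inertiaIndex 1 hA : ℤ) - inertiaIndex (-1) hA := by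
  simp [hermSignature, inertiaIndex]

theorem inertiaIndex_add_inertiaIndex_add_card_eq {N : ℕ} {A : Matrix (Fin N) (Fin N) ℂ}
    (hA : A.IsHermitian) :
    inertiaIndex 1 hA + inertiaIndex (-1) hA +
      (Finset.univ.filter fun i => hA.eigenvalues i = 0).card = N := by
  simp only [inertiaIndex, Finset.card_filter, ← Finset.sum_add_distrib]
  trans ∑ i : Fin N, 1
  · refine Finset.sum_congr rfl fun i _ => ?_
    rcases lt_trichotomy (hA.eigenvalues i) 0 with h | h | h
    · simp [h, h.not_gt, h.ne]
    · simp [h]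
    · simp [h, h.not_gt, h.ne']
  · simp

/-- A Hermitian form is a weighted sum of squares in its eigenvector coordinates. -/
theorem Matrix.IsHermitian.re_star_dotProduct_mulVec {n : Type*} [Fintype n] [DecidableEq n]
    {A : Matrix n n ℂ} (hA : A.IsHermitian) (v : n → ℂ) :
    (star v ⬝ᵥ (A *ᵥ v)).re =
      ∑ i, hA.eigenvalues i *
        Complex.normSq (((hA.eigenvectorUnitary : Matrix n n ℂ)ᴴ *ᵥ v) i) := by
  set U : Matrix n n ℂ := (hA.eigenvectorUnitary : Matrix n n ℂ)
  have hs : A = U * diagonal (RCLike.ofReal ∘ hA.eigenvalues) * Uᴴ := by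
    conv_lhs => rw [hA.spectral_theorem, Unitary.conjStarAlgAut_apply]
    rfl
  have h : star v ⬝ᵥ (A *ᵥ v) =
      star (Uᴴ *ᵥ v) ⬝ᵥ (diagonal (RCLike.ofReal ∘ hA.eigenvalues) *ᵥ (Uᴴ *ᵥ v)) := by
    conv_lhs => rw [hs]
    rw [star_mulVec, conjTranspose_conjTranspose, ← dotProduct_mulVec, mulVec_mulVec,
      mulVec_mulVec, Matrix.mul_assoc]
  rw [h, dotProduct, Complex.re_sum]
  refine Finset.sum_congr rfl fun i _ => ?_
  simp [mulVec_diagonal, Complex.normSq_apply]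
  ring

/-- If a Hermitian form is definite of sign `σ` on the image of a matrix with column type `m`,
then it has at least `card m` eigenvalues of sign `σ`. -/
theorem card_le_inertiaIndex {N : ℕ} {A : Matrix (Fin N) (Fin N) ℂ} {m : Type*} [Fintype m]
    (σ : ℝ) (hA : A.IsHermitian) (L : Matrix (Fin N) m ℂ)
    (h : ∀ c : m → ℂ, c ≠ 0 → 0 < σ * (star (L *ᵥ c) ⬝ᵥ (A *ᵥ (L *ᵥ c))).re) :
    Fintype.card m ≤ inertiaIndex σ hA := by
  let T : (m → ℂ) →ₗ[ℂ] ({i // 0 < σ * hA.eigenvalues i} → ℂ) :=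
    (LinearMap.funLeft ℂ ℂ Subtype.val) ∘ₗ
      ((hA.eigenvectorUnitary : Matrix (Fin N) (Fin N) ℂ)ᴴ * L).mulVecLin
  have hT : Function.Injective T := by
    rw [← LinearMap.ker_eq_bot, LinearMap.ker_eq_bot']
    intro c hc
    by_contra hne
    refine (h c hne).not_ge ?_
    rw [hA.re_star_dotProduct_mulVec, Finset.mul_sum]
    refine Finset.sum_nonpos fun i _ => ?_
    rw [← mul_assoc]
    by_cases hi : 0 < σ * hA.eigenvalues i
    · have : (((hA.eigenvectorUnitary : Matrix (Fin N) (Fin N) ℂ)ᴴ * L) *ᵥ c) i = 0 :=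
        congrFun hc ⟨i, hi⟩
      rw [mulVec_mulVec, this]
      simp
    · exact mul_nonpos_of_nonpos_of_nonneg (not_lt.1 hi) (Complex.normSq_nonneg _)
  have := LinearMap.finrank_le_finrank_of_injective hT
  simpa [inertiaIndex, Fintype.card_subtype] using this

/-- The inertia indices of a continuous family of Hermitian matrices are lower semicontinuous. -/
theorem eventually_inertiaIndex_le {X : Type*} [TopologicalSpace X] {N : ℕ}
    {A : X → Matrix (Fin N) (Fin N) ℂ} (hA : ∀ x, (A x).IsHermitian) (σ : ℝ) {x₀ : X}
    (hc : ContinuousAt A x₀) :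
    ∀ᶠ x in 𝓝 x₀, inertiaIndex σ (hA x₀) ≤ inertiaIndex σ (hA x) := by
  let m := {i // 0 < σ * (hA x₀).eigenvalues i}
  let U : Matrix (Fin N) (Fin N) ℂ := (hA x₀).eigenvectorUnitary
  let L : Matrix (Fin N) m ℂ := U.submatrix id Subtype.val
  have hUL : Uᴴ * L = (1 : Matrix (Fin N) (Fin N) ℂ).submatrix id Subtype.val := by
    have : Uᴴ * U = 1 := Unitary.coe_star_mul_self (hA x₀).eigenvectorUnitary
    rw [← this]
    rfl
  have hpos : ∀ c : m → ℂ, c ≠ 0 → 0 < σ * (star (L *ᵥ c) ⬝ᵥ (A x₀ *ᵥ (L *ᵥ c))).re := by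
    intro c hc
    rw [(hA x₀).re_star_dotProduct_mulVec, Finset.mul_sum]
    simp only [mulVec_mulVec, ← mul_assoc]
    change 0 < ∑ i, σ * (hA x₀).eigenvalues i * Complex.normSq (((Uᴴ * L) *ᵥ c) i)
    rw [hUL]
    have hin (i : m) :
        ((1 : Matrix (Fin N) (Fin N) ℂ).submatrix id (Subtype.val : m → Fin N) *ᵥ c) i = c i := by
      simp [mulVec, dotProduct, one_apply, Subtype.val_inj]
    have hout (i : Fin N) (hi : ¬ 0 < σ * (hA x₀).eigenvalues i) :
        ((1 : Matrix (Fin N) (Fin N) ℂ).submatrix id (Subtype.val : m → Fin N) *ᵥ c) i = 0 := by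
      simp only [mulVec, dotProduct, submatrix_apply, id, one_apply, ite_mul, one_mul, zero_mul]
      refine Finset.sum_eq_zero fun j _ => if_neg ?_
      rintro rfl
      exact hi j.2
    obtain ⟨k, hk⟩ := Function.ne_iff.1 hc
    refine Finset.sum_pos' (fun i _ => ?_) ⟨k, Finset.mem_univ _, ?_⟩
    · by_cases hi : 0 < σ * (hA x₀).eigenvalues i
      · exact mul_nonneg hi.le (Complex.normSq_nonneg _)
      · simp [hout i hi]
    · rw [hin k]
      exact mul_pos k.2 (Complex.normSq_pos.2 hk)
  have hev : ∀ᶠ x in 𝓝 x₀, ∀ c ∈ Metric.sphere (0 : m → ℂ) 1,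
      0 < σ * (star (L *ᵥ c) ⬝ᵥ (A x *ᵥ (L *ᵥ c))).re := by
    refine (isCompact_sphere _ _).eventually_forall_of_forall_eventually fun c hcs => ?_
    have hcont : ContinuousAt
        (fun z : X × (m → ℂ) => σ * (star (L *ᵥ z.2) ⬝ᵥ (A z.1 *ᵥ (L *ᵥ z.2))).re) (x₀, c) := by
      have h1 : ContinuousAt (fun z : X × (m → ℂ) => A z.1) (x₀, c) :=
        ContinuousAt.comp (f := Prod.fst) hc continuousAt_fst
      have h2 : Continuous fun z : Matrix (Fin N) (Fin N) ℂ × (m → ℂ) =>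
          σ * (star (L *ᵥ z.2) ⬝ᵥ (z.1 *ᵥ (L *ᵥ z.2))).re := by
        have h3 : Continuous fun z : Matrix (Fin N) (Fin N) ℂ × (m → ℂ) => L *ᵥ z.2 :=
          continuous_const.matrix_mulVec continuous_snd
        exact continuous_const.mul (Complex.continuous_re.comp
          (h3.star.dotProduct (continuous_fst.matrix_mulVec h3)))
      exact ContinuousAt.comp (f := fun z : X × (m → ℂ) => (A z.1, z.2)) h2.continuousAt
        (h1.prodMk continuousAt_snd)
    refine hcont.eventually (lt_mem_nhds (hpos c ?_))
    rintro rfl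
    simp at hcs
  filter_upwards [hev] with x hx
  have := card_le_inertiaIndex σ (hA x) L fun c hc0 => by
    have hn : (0 : ℝ) < ‖c‖ := norm_pos_iff.2 hc0
    have h1 := hx ((‖c‖⁻¹ : ℝ) • c) (by simp [norm_smul, hn.ne'])
    have h2 : σ * (star (L *ᵥ ((‖c‖⁻¹ : ℝ) • c)) ⬝ᵥ (A x *ᵥ (L *ᵥ ((‖c‖⁻¹ : ℝ) • c)))).re =
        (‖c‖⁻¹ * ‖c‖⁻¹) * (σ * (star (L *ᵥ c) ⬝ᵥ (A x *ᵥ (L *ᵥ c))).re) := by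
      simp only [mulVec_smul, star_smul, smul_dotProduct, dotProduct_smul, Complex.smul_re,
        star_trivial, smul_eq_mul]
      ring
    rw [h2] at h1
    exact pos_of_mul_pos_right h1 (by positivity)
  simpa [m, inertiaIndex, Fintype.card_subtype] using this

theorem neg_one_pow_card_neg_mul_prod_pos {ι : Type*} [Fintype ι] (x : ι → ℝ)
    (hx : ∀ i, x i ≠ 0) :
    0 < (-1 : ℝ) ^ (Finset.univ.filter fun i => 0 < -1 * x i).card * ∏ i, x i := by
  have : (-1 : ℝ) ^ (Finset.univ.filter fun i => 0 < -1 * x i).card =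
      ∏ i, if 0 < -1 * x i then (-1 : ℝ) else 1 := by
    simp [Finset.prod_ite]
  rw [this, ← Finset.prod_mul_distrib]
  refine Finset.prod_pos fun i _ => ?_
  split_ifs with h
  · exact h
  · rw [one_mul]
    exact lt_of_le_of_ne (by linarith) (hx i).symm

/-- The determinant of a differentiable family of matrices has zero derivative at a point where
two of the columns vanish. -/
theorem hasDerivAt_det_zero_of_two_columns_zero {n : Type*} [Fintype n] [DecidableEq n]
    {B : ℝ → Matrix n n ℂ} {t₀ : ℝ} (hB : ∀ i j, DifferentiableAt ℝ (fun t => B t i j) t₀)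
    {i j : n} (hij : i ≠ j) (hi : ∀ k, B t₀ k i = 0) (hj : ∀ k, B t₀ k j = 0) :
    HasDerivAt (fun t => (B t).det) 0 t₀ := by
  simp only [det_apply]
  have key (σ : Equiv.Perm n) :
      HasDerivAt (fun t => Equiv.Perm.sign σ • ∏ k, B t (σ k) k) 0 t₀ := by
    have hrest : DifferentiableAt ℝ
        (fun t => ∏ k ∈ (Finset.univ.erase i).erase j, B t (σ k) k) t₀ :=
      DifferentiableAt.fun_finsetProd fun k _ => hB _ _
    have h := ((hB (σ i) i).hasDerivAt.fun_mul
      ((hB (σ j) j).hasDerivAt.fun_mul hrest.hasDerivAt)).const_mul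
        (((Equiv.Perm.sign σ : ℤˣ) : ℤ) : ℂ)
    simp only [hi, hj, zero_mul, mul_zero, add_zero] at h
    refine h.congr_of_eventuallyEq (Eventually.of_forall fun t => ?_)
    dsimp only
    rw [← Finset.mul_prod_erase Finset.univ _ (Finset.mem_univ i),
      ← Finset.mul_prod_erase (Finset.univ.erase i) _
        (Finset.mem_erase.2 ⟨hij.symm, Finset.mem_univ j⟩)]
    simp [Units.smul_def]
  simpa using HasDerivAt.fun_sum fun σ (_ : σ ∈ Finset.univ) => key σ

/-- If the determinant of a family of matrices that is Hermitian at `t₀` has nonzero derivative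
there, then at most one eigenvalue vanishes at `t₀`. -/
theorem card_eigenvalues_eq_zero_le_one {N : ℕ} {A : ℝ → Matrix (Fin N) (Fin N) ℂ} {t₀ : ℝ}
    (hA : (A t₀).IsHermitian) (hd : ∀ i j, DifferentiableAt ℝ (fun t => A t i j) t₀)
    (h : deriv (fun t => (A t).det) t₀ ≠ 0) :
    (Finset.univ.filter fun i => hA.eigenvalues i = 0).card ≤ 1 := by
  by_contra! hcard
  obtain ⟨i, hi, j, hj, hij⟩ := Finset.one_lt_card.1 hcard
  simp only [Finset.mem_filter, Finset.mem_univ, true_and] at hi hj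
  let U : Matrix (Fin N) (Fin N) ℂ := hA.eigenvectorUnitary
  have hUU : U * Uᴴ = 1 := Unitary.coe_mul_star_self hA.eigenvectorUnitary
  have hdiag : Uᴴ * A t₀ * U = diagonal (RCLike.ofReal ∘ hA.eigenvalues) := by
    rw [← hA.conjStarAlgAut_star_eigenvectorUnitary, Unitary.conjStarAlgAut_star_apply]
    rfl
  have hdet : (fun t => (A t).det) = fun t => (Uᴴ * A t * U).det := by
    ext t
    rw [det_mul_comm, ← Matrix.mul_assoc, hUU, Matrix.one_mul]
  refine h (hdet ▸ (hasDerivAt_det_zero_of_two_columns_zero ?_ hij ?_ ?_).deriv)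
  · intro k l
    simp only [mul_apply]
    fun_prop
  · intro k
    rw [hdiag, diagonal_apply]
    split_ifs with hk <;> simp [hk, hi]
  · intro k
    rw [hdiag, diagonal_apply]
    split_ifs with hk <;> simp [hk, hj]

/-- The inertia indices of a continuous family of invertible Hermitian matrices are constant on
preconnected sets. -/
theorem inertiaIndex_eq_of_isPreconnected {X : Type*} [TopologicalSpace X] {N : ℕ}
    {A : X → Matrix (Fin N) (Fin N) ℂ} (hA : ∀ x, (A x).IsHermitian) {S : Set X}
    (hS : IsPreconnected S) (hc : ∀ x ∈ S, ContinuousAt A x)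
    (hsum : ∀ x ∈ S, inertiaIndex 1 (hA x) + inertiaIndex (-1) (hA x) = N) {x y : X}
    (hx : x ∈ S) (hy : y ∈ S) :
    inertiaIndex 1 (hA x) = inertiaIndex 1 (hA y) ∧
      inertiaIndex (-1) (hA x) = inertiaIndex (-1) (hA y) := by
  have hn : inertiaIndex (-1) (hA x) = inertiaIndex (-1) (hA y) := by
    refine hS.constant (f := fun x => inertiaIndex (-1) (hA x)) (fun z hz => ?_) hx hy
    refine tendsto_nhds_of_eventually_eq ?_
    filter_upwards [self_mem_nhdsWithin,
      nhdsWithin_le_nhds (eventually_inertiaIndex_le hA 1 (hc z hz)),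
      nhdsWithin_le_nhds (eventually_inertiaIndex_le hA (-1) (hc z hz))] with w hw h1 h2
    have := hsum w hw
    have := hsum z hz
    lia
  have := hsum x hx
  have := hsum y hy
  lia

theorem signature_jump_at_simple_root (N : ℕ) (hN : 1 ≤ N) (t₀ ε : ℝ) (hε : 0 < ε)
    (A : ℝ → Matrix (Fin N) (Fin N) ℂ)
    (hHerm : ∀ t, (A t).IsHermitian)
    (hre : ∀ i j, AnalyticOn ℝ (fun t => ((A t) i j).re)
      (Set.Ioo (t₀ - 2 * ε) (t₀ + 2 * ε)))
    (him : ∀ i j, AnalyticOn ℝ (fun t => ((A t) i j).im)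
      (Set.Ioo (t₀ - 2 * ε) (t₀ + 2 * ε)))
    (hzero : (A t₀).det = 0)
    (hsimple : deriv (fun t => (A t).det) t₀ ≠ 0)
    (hnz : ∀ t ∈ Set.Ioo (t₀ - 2 * ε) (t₀ + 2 * ε), t ≠ t₀ → (A t).det ≠ 0) :
    |hermSignature (hHerm (t₀ + ε)) - hermSignature (hHerm (t₀ - ε))| = 2 ∧
    2 * hermSignature (hHerm t₀) =
      hermSignature (hHerm (t₀ + ε)) + hermSignature (hHerm (t₀ - ε)) ∧
    nullity (A t₀) = 1 ∧ (A t₀).rank = N - 1 := by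
  have hdiff : ∀ t ∈ Set.Ioo (t₀ - 2 * ε) (t₀ + 2 * ε), ∀ i j,
      DifferentiableAt ℝ (fun t => A t i j) t := by
    intro t ht i j
    have h1 := ((hre i j).differentiableOn t ht).differentiableAt (isOpen_Ioo.mem_nhds ht)
    have h2 := ((him i j).differentiableOn t ht).differentiableAt (isOpen_Ioo.mem_nhds ht)
    have h3 := (Complex.ofRealCLM.differentiableAt.comp t h1).add
      ((Complex.ofRealCLM.differentiableAt.comp t h2).mul_const Complex.I)
    refine h3.congr_of_eventuallyEq (Eventually.of_forall fun s => ?_)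
    exact (Complex.re_add_im (A s i j)).symm
  have hcont : ∀ t ∈ Set.Ioo (t₀ - 2 * ε) (t₀ + 2 * ε), ContinuousAt A t := fun t ht =>
    continuousAt_pi.2 fun i => continuousAt_pi.2 fun j => (hdiff t ht i j).continuousAt
  have ht₀ : t₀ ∈ Set.Ioo (t₀ - 2 * ε) (t₀ + 2 * ε) := ⟨by linarith, by linarith⟩
  have hprod (t : ℝ) : (A t).det = ((∏ i, (hHerm t).eigenvalues i : ℝ) : ℂ) := by
    rw [(hHerm t).det_eq_prod_eigenvalues]
    simp
  have heig {t : ℝ} (h : (A t).det ≠ 0) (i : Fin N) : (hHerm t).eigenvalues i ≠ 0 := by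
    rw [hprod, Complex.ofReal_ne_zero] at h
    exact Finset.prod_ne_zero_iff.1 h i (Finset.mem_univ i)
  have hsum {t : ℝ} (h : (A t).det ≠ 0) :
      inertiaIndex 1 (hHerm t) + inertiaIndex (-1) (hHerm t) = N := by
    have := inertiaIndex_add_inertiaIndex_add_card_eq (hHerm t)
    rwa [Finset.filter_eq_empty_iff.2 fun i _ => heig h i, Finset.card_empty, add_zero] at this
  have hcard : (Finset.univ.filter fun i => (hHerm t₀).eigenvalues i = 0).card = 1 := by
    refine le_antisymm (card_eigenvalues_eq_zero_le_one _ (hdiff t₀ ht₀) hsimple) ?_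
    rw [hprod, Complex.ofReal_eq_zero, Finset.prod_eq_zero_iff] at hzero
    obtain ⟨i, -, hi⟩ := hzero
    exact Finset.card_pos.2 ⟨i, by simpa using hi⟩
  have hsum₀ := inertiaIndex_add_inertiaIndex_add_card_eq (hHerm t₀)
  rw [hcard] at hsum₀
  have hrank : (A t₀).rank = N - 1 := by
    rw [(hHerm t₀).rank_eq_card_non_zero_eigs, Fintype.card_subtype_compl,
      Fintype.card_subtype, hcard, Fintype.card_fin]
  have hnull : nullity (A t₀) = 1 := by
    have h := LinearMap.finrank_range_add_finrank_ker (Matrix.toLin' (A t₀))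
    have h' : Module.finrank ℂ (LinearMap.range (Matrix.toLin' (A t₀))) = N - 1 := hrank
    rw [h', Module.finrank_fin_fun] at h
    unfold nullity
    lia
  have hright : ∀ t ∈ Set.Ioo t₀ (t₀ + 2 * ε),
      inertiaIndex 1 (hHerm t) = inertiaIndex 1 (hHerm (t₀ + ε)) ∧
        inertiaIndex (-1) (hHerm t) = inertiaIndex (-1) (hHerm (t₀ + ε)) := fun t ht =>
    inertiaIndex_eq_of_isPreconnected hHerm isPreconnected_Ioo
      (fun x hx => hcont x ⟨by linarith [hx.1], hx.2⟩)
      (fun x hx => hsum (hnz x ⟨by linarith [hx.1], hx.2⟩ hx.1.ne')) ht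
      ⟨by linarith, by linarith⟩
  have hleft : ∀ t ∈ Set.Ioo (t₀ - 2 * ε) t₀,
      inertiaIndex 1 (hHerm t) = inertiaIndex 1 (hHerm (t₀ - ε)) ∧
        inertiaIndex (-1) (hHerm t) = inertiaIndex (-1) (hHerm (t₀ - ε)) := fun t ht =>
    inertiaIndex_eq_of_isPreconnected hHerm isPreconnected_Ioo
      (fun x hx => hcont x ⟨hx.1, by linarith [hx.2]⟩)
      (fun x hx => hsum (hnz x ⟨hx.1, by linarith [hx.2]⟩ hx.2.ne)) ht
      ⟨by linarith, by linarith⟩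
  have hge (σ : ℝ) := eventually_inertiaIndex_le hHerm σ (hcont t₀ ht₀)
  obtain ⟨a, ⟨ha1, ha2⟩, ha⟩ :=
    ((((hge 1).and (hge (-1))).filter_mono nhdsWithin_le_nhds).and
      (Ioo_mem_nhdsGT (show t₀ < t₀ + 2 * ε by linarith))).exists
  obtain ⟨b, ⟨hb1, hb2⟩, hb⟩ :=
    ((((hge 1).and (hge (-1))).filter_mono nhdsWithin_le_nhds).and
      (Ioo_mem_nhdsLT (show t₀ - 2 * ε < t₀ by linarith))).exists
  rw [(hright a ha).1] at ha1
  rw [(hright a ha).2] at ha2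
  rw [(hleft b hb).1] at hb1
  rw [(hleft b hb).2] at hb2
  have hne : inertiaIndex (-1) (hHerm (t₀ + ε)) ≠ inertiaIndex (-1) (hHerm (t₀ - ε)) := by
    intro heq
    set k := inertiaIndex (-1) (hHerm (t₀ + ε))
    set g : ℝ → ℝ := fun t => ∏ i, (hHerm t).eigenvalues i with hg
    have hfg : (fun t => (A t).det) = fun t => (g t : ℂ) := funext hprod
    have hg₀ : g t₀ = 0 := by
      have := hprod t₀
      rw [hzero] at this
      exact_mod_cast this.symm
    have hmin : IsLocalMin (fun t => (-1 : ℝ) ^ k * g t) t₀ := by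
      filter_upwards [isOpen_Ioo.mem_nhds ht₀] with t ht
      rw [hg₀, mul_zero]
      rcases eq_or_ne t t₀ with rfl | htne
      · simp [hg₀]
      · have hk : inertiaIndex (-1) (hHerm t) = k := by
          rcases htne.lt_or_gt with hlt | hgt
          · exact (hleft t ⟨ht.1, hlt⟩).2.trans heq.symm
          · exact (hright t ⟨hgt, ht.2⟩).2
        have := neg_one_pow_card_neg_mul_prod_pos _ (heig (hnz t ht htne))
        rw [← hk]
        exact this.le
    have hd : HasDerivAt g (deriv (fun t => (A t).det) t₀).re t₀ := by
      have h := (differentiableAt_of_deriv_ne_zero hsimple).hasDerivAt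
      have := Complex.reCLM.hasFDerivAt.comp_hasDerivAt t₀ h
      simpa [hfg, Function.comp_def] using this
    have hd0 := hmin.hasDerivAt_eq_zero (hd.const_mul ((-1 : ℝ) ^ k))
    have hre0 : (deriv (fun t => (A t).det) t₀).re = 0 := by simpa using hd0
    rw [hre0] at hd
    apply hsimple
    rw [hfg]
    simpa using hd.ofReal_comp.deriv
  have hs1 := hsum (hnz (t₀ + ε) ⟨by linarith, by linarith⟩ (by linarith))
  have hs2 := hsum (hnz (t₀ - ε) ⟨by linarith, by linarith⟩ (by linarith))
  simp only [hermSignature_eq_inertiaIndex_sub]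
  refine ⟨?_, ?_, hnull, hrank⟩
  · rw [abs_eq (by norm_num)]
    lia
  · lia
end

section
/- Assume the Seifert data. Let k be an integer with 0 < k < m and set θ = k/m. Then, in the parallelogram Π(a,b,c,d) with (a,b) = (a₁n + m₁, m₂) and (c,d) = (m₁, a₂n + m₂), one has −2·( ((s₁k/m)) + ((s₂k/m)) + n·((k/m)) ) = M_θ⁺ − M_θ⁻. -/
open scoped Classical

/-- The sawtooth function: `((x)) = 1/2 - x + ⌊x⌋` for `x ∉ ℤ` and `((x)) = 0` for `x ∈ ℤ`. -/
noncomputable def saw (x : ℝ) : ℝ :=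
  if ∃ n : ℤ, (n : ℝ) = x then 0 else 1 / 2 - x + ⌊x⌋

/-- The open parallelogram spanned by `(a,b)` and `(c,d)`. -/
def para (a b c d : ℤ) : Set (ℝ × ℝ) :=
  {P | ∃ s t : ℝ, 0 < s ∧ s < 1 ∧ 0 < t ∧ t < 1 ∧
    P = (s * a + t * c, s * b + t * d)}

/-- The linear function with `u(a,b) = u(c,d) = 1`. -/
noncomputable def uFun (a b c d : ℤ) (P : ℝ × ℝ) : ℝ :=
  (((d : ℝ) - b) * P.1 + ((a : ℝ) - c) * P.2) / ((a : ℝ) * d - b * c)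

/-- The number of lattice points in the open parallelogram on which `u` takes the value `θ`. -/
noncomputable def Mcount (a b c d : ℤ) (θ : ℝ) : ℕ :=
  {p : ℤ × ℤ | ((p.1 : ℝ), (p.2 : ℝ)) ∈ para a b c d ∧
    uFun a b c d ((p.1 : ℝ), (p.2 : ℝ)) = θ}.ncard

theorem neg_two_mul_saw (x : ℝ) : -2 * saw x = 2 * x - ⌊x⌋ - ⌈x⌉ := by
  unfold saw
  split_ifs with h
  · obtain ⟨z, rfl⟩ := h
    simp
    ring
  · have hne : (⌊x⌋ : ℝ) ≠ x := fun e => h ⟨_, e⟩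
    have hc : ⌈x⌉ = ⌊x⌋ + 1 := by
      rw [Int.ceil_eq_iff]
      push_cast
      exact ⟨by linarith [lt_of_le_of_ne (Int.floor_le x) hne], (Int.lt_floor_add_one x).le⟩
    rw [hc]
    push_cast
    ring

/-- For the Seifert parallelogram, being a lattice point of level `θ` amounts to one linear equation
and bounds on the two coordinates. -/
theorem mem_para_and_uFun_eq_iff {a₁ a₂ n m₁ m₂ m : ℤ} (ha₁ : 0 < a₁) (ha₂ : 0 < a₂) (hn : 0 < n)
    (hm : m = m₁ * a₂ + m₂ * a₁ + n * (a₁ * a₂)) (hm0 : 0 < m) (θ x y : ℝ) :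
    ((x, y) ∈ para (a₁ * n + m₁) m₂ m₁ (a₂ * n + m₂) ∧
      uFun (a₁ * n + m₁) m₂ m₁ (a₂ * n + m₂) (x, y) = θ) ↔
    a₂ * x + a₁ * y = θ * m ∧ (0 < x - θ * m₁ ∧ x - θ * m₁ < a₁ * n) ∧
      (0 < y - θ * m₂ ∧ y - θ * m₂ < a₂ * n) := by
  have h₁ : (0 : ℝ) < a₁ * n := by exact_mod_cast mul_pos ha₁ hn
  have h₂ : (0 : ℝ) < a₂ * n := by exact_mod_cast mul_pos ha₂ hn
  have hn' : (0 : ℝ) < n := by exact_mod_cast hn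
  have hm0' : (0 : ℝ) < m := by exact_mod_cast hm0
  have hm' : (m : ℝ) = m₁ * a₂ + m₂ * a₁ + n * (a₁ * a₂) := by exact_mod_cast hm
  have hu : uFun (a₁ * n + m₁) m₂ m₁ (a₂ * n + m₂) (x, y) = (a₂ * x + a₁ * y) / m := by
    unfold uFun
    push_cast
    rw [show ((a₁ : ℝ) * n + m₁) * (a₂ * n + m₂) - m₂ * m₁ = n * m by rw [hm']; ring]
    field_simp
    ring
  rw [hu, div_eq_iff hm0'.ne']
  constructor
  · rintro ⟨⟨s, t, hs0, hs1, ht0, ht1, he⟩, hθ⟩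
    obtain ⟨rfl, rfl⟩ := Prod.mk.inj he
    push_cast at hθ ⊢
    have hst : s + t = θ := by
      apply mul_right_cancel₀ hm0'.ne'
      rw [← hθ, hm']
      ring
    have e₁ : s * (a₁ * n + m₁) + t * m₁ - θ * m₁ = s * (a₁ * n : ℝ) := by rw [← hst]; ring
    have e₂ : s * m₂ + t * (a₂ * n + m₂) - θ * m₂ = t * (a₂ * n : ℝ) := by rw [← hst]; ring
    rw [e₁, e₂]
    exact ⟨hθ, ⟨mul_pos hs0 h₁, mul_lt_of_lt_one_left h₁ hs1⟩,
      mul_pos ht0 h₂, mul_lt_of_lt_one_left h₂ ht1⟩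
  · rintro ⟨hθ, ⟨hx0, hx1⟩, hy0, hy1⟩
    have a₁0 : (a₁ : ℝ) ≠ 0 := by exact_mod_cast ha₁.ne'
    have a₂0 : (a₂ : ℝ) ≠ 0 := by exact_mod_cast ha₂.ne'
    have hst : (x - θ * m₁) / (a₁ * n) + (y - θ * m₂) / (a₂ * n) = θ := by
      field_simp
      rw [hm'] at hθ
      linarith
    refine ⟨⟨(x - θ * m₁) / (a₁ * n), (y - θ * m₂) / (a₂ * n), div_pos hx0 h₁,
      (div_lt_one h₁).2 hx1, div_pos hy0 h₂, (div_lt_one h₂).2 hy1, ?_⟩, hθ⟩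
    push_cast
    refine Prod.ext ?_ ?_
    · calc x = (x - θ * m₁) / (a₁ * n) * (a₁ * n) + θ * m₁ := by
            rw [div_mul_cancel₀ _ h₁.ne']; ring
        _ = _ := by linear_combination (-m₁ : ℝ) * hst
    · calc y = (y - θ * m₂) / (a₂ * n) * (a₂ * n) + θ * m₂ := by
            rw [div_mul_cancel₀ _ h₂.ne']; ring
        _ = _ := by linear_combination (-m₂ : ℝ) * hst

/-- If the set counted by `Mcount` consists of the points `(x₀ + a₁ j, y₀ - a₂ j)` with
`l < j < r`, its size is the number of integers in the interval `(l, r)`. -/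
theorem Mcount_eq_of_forall_iff {a b c d a₁ a₂ x₀ y₀ : ℤ} {θ l r : ℝ} (ha₁ : a₁ ≠ 0) (hlr : l < r)
    (h : ∀ x y : ℤ, (((x : ℝ), (y : ℝ)) ∈ para a b c d ∧ uFun a b c d (x, y) = θ) ↔
      ∃ j : ℤ, (l < j ∧ j < r) ∧ x = x₀ + a₁ * j ∧ y = y₀ - a₂ * j) :
    (Mcount a b c d θ : ℝ) = ⌈r⌉ - ⌊l⌋ - 1 := by
  have hset : {p : ℤ × ℤ | ((p.1 : ℝ), (p.2 : ℝ)) ∈ para a b c d ∧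
      uFun a b c d ((p.1 : ℝ), (p.2 : ℝ)) = θ} =
      (fun j : ℤ => (x₀ + a₁ * j, y₀ - a₂ * j)) '' (Finset.Ioo ⌊l⌋ ⌈r⌉ : Finset ℤ) := by
    ext ⟨x, y⟩
    simp only [Set.mem_ofPred_eq, h, Set.mem_image, Finset.mem_coe, Finset.mem_Ioo, Int.floor_lt,
      Int.lt_ceil, Prod.mk.injEq, @eq_comm _ x, @eq_comm _ y]
  have hinj : Function.Injective (fun j : ℤ => (x₀ + a₁ * j, y₀ - a₂ * j)) := by
    intro i j hij
    exact mul_left_cancel₀ ha₁ (add_left_cancel (Prod.mk.inj hij).1)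
  have hle : ⌊l⌋ < ⌈r⌉ := Int.lt_ceil.2 ((Int.floor_le l).trans_lt hlr)
  unfold Mcount
  rw [hset, Set.ncard_image_of_injective _ hinj, Set.ncard_coe_finset, Int.card_Ioo]
  have : (((⌈r⌉ - ⌊l⌋ - 1).toNat : ℤ) : ℝ) = ((⌈r⌉ - ⌊l⌋ - 1 : ℤ) : ℝ) := by
    rw [Int.toNat_of_nonneg (by omega)]
  push_cast at this
  exact_mod_cast this

/-- Parametrization of the integer solutions of `a₂ x + a₁ y = a₂ x₀ + a₁ y₀`. -/
theorem exists_eq_add_mul_of_linear_eq {a₁ a₂ b₁ b₂ x₀ y₀ x y : ℤ}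
    (hb : a₁ * b₂ + a₂ * b₁ = 1) (h : a₂ * x + a₁ * y = a₂ * x₀ + a₁ * y₀) :
    ∃ j : ℤ, x = x₀ + a₁ * j ∧ y = y₀ - a₂ * j :=
  ⟨b₂ * (x - x₀) - b₁ * (y - y₀),
    by linear_combination (x₀ - x) * hb + b₁ * h, by linear_combination (y₀ - y) * hb + b₂ * h⟩

theorem neumann_sum_eq_M_difference
    (a₁ a₂ n m₁ m₂ b₁ b₂ m : ℤ) (s₁ s₂ : ℚ)
    (ha₁ : 0 < a₁) (ha₂ : 0 < a₂) (hcop : IsCoprime a₁ a₂) (hn : 0 < n)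
    (hm₁ : m₁ = 0 ∨ m₁ = 1) (hm₂ : m₂ = 0 ∨ m₂ = 1)
    (hb : a₁ * b₂ + a₂ * b₁ = 1)
    (hm : m = m₁ * a₂ + m₂ * a₁ + n * (a₁ * a₂))
    (hs₁ : s₁ = ((m₁ : ℚ) - b₁ * m) / a₁) (hs₂ : s₂ = ((m₂ : ℚ) - b₂ * m) / a₂)
    (k : ℤ) (hk0 : 0 < k) (hkm : k < m) :
    -2 * (saw ((s₁ * k / m : ℚ) : ℝ) + saw ((s₂ * k / m : ℚ) : ℝ)
        + (n : ℝ) * saw ((k : ℝ) / (m : ℝ))) =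
      (Mcount (a₁ * n + m₁) m₂ m₁ (a₂ * n + m₂) ((k : ℝ) / (m : ℝ)) : ℝ)
      - (Mcount (a₁ * n + m₁) m₂ m₁ (a₂ * n + m₂) ((k : ℝ) / (m : ℝ) + 1) : ℝ) := by
  have hm0 : 0 < m := hk0.trans hkm
  have hm0' : (0 : ℝ) < m := by exact_mod_cast hm0
  have hk0' : (0 : ℝ) < k := by exact_mod_cast hk0
  have hkm' : (k : ℝ) < m := by exact_mod_cast hkm
  have hn' : (0 : ℝ) < n := by exact_mod_cast hn
  have ha₁' : (0 : ℝ) < a₁ := by exact_mod_cast ha₁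
  have ha₂' : (0 : ℝ) < a₂ := by exact_mod_cast ha₂
  have hm' : (m : ℝ) = m₁ * a₂ + m₂ * a₁ + n * (a₁ * a₂) := by exact_mod_cast hm
  have hb' : (a₁ : ℝ) * b₂ + a₂ * b₁ = 1 := by exact_mod_cast hb
  obtain ⟨θ, hθ⟩ : ∃ θ : ℝ, θ = k / m := ⟨_, rfl⟩
  obtain ⟨α, hα⟩ : ∃ α : ℝ, α = ((s₁ * k / m : ℚ) : ℝ) := ⟨_, rfl⟩
  obtain ⟨β, hβ⟩ : ∃ β : ℝ, β = ((s₂ * k / m : ℚ) : ℝ) := ⟨_, rfl⟩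
  rw [← hα, ← hβ, ← hθ]
  have hθm : θ * m = k := by rw [hθ]; field_simp
  have hθ0 : 0 < θ := by rw [hθ]; positivity
  have hθ1 : θ < 1 := by rw [hθ]; exact (div_lt_one hm0').2 hkm'
  have hα' : a₁ * α = m₁ * θ - b₁ * k := by
    rw [hα, hs₁, hθ]; push_cast; field_simp
  have hβ' : a₂ * β = m₂ * θ - b₂ * k := by
    rw [hβ, hs₂, hθ]; push_cast; field_simp
  have hαβ : α + β = -n * θ := by
    apply mul_left_cancel₀ (mul_pos ha₁' ha₂').ne'
    linear_combination (a₂ : ℝ) * hα' + a₁ * hβ' - k * hb' + hθm - θ * hm'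
  have hnθ0 : 0 < n * θ := mul_pos hn' hθ0
  have hnθ1 : n * θ < n := mul_lt_of_lt_one_right hn' hθ1
  have hplus : (Mcount (a₁ * n + m₁) m₂ m₁ (a₂ * n + m₂) θ : ℝ) = ⌈-β⌉ - ⌊α⌋ - 1 := by
    refine Mcount_eq_of_forall_iff (a₁ := a₁) (a₂ := a₂) (x₀ := b₁ * k) (y₀ := b₂ * k)
      ha₁.ne' (by linarith) fun x y => ?_
    rw [mem_para_and_uFun_eq_iff ha₁ ha₂ hn hm hm0]
    have ex (j : ℝ) : b₁ * k + a₁ * j - θ * m₁ = a₁ * (j - α) := by linear_combination hα'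
    have ey (j : ℝ) : b₂ * k - a₂ * j - θ * m₂ = a₂ * (-j - β) := by linear_combination hβ'
    constructor
    · rintro ⟨he, ⟨hx, -⟩, hy, -⟩
      obtain ⟨j, rfl, rfl⟩ := exists_eq_add_mul_of_linear_eq (x := x) (y := y) (x₀ := b₁ * k)
        (y₀ := b₂ * k) hb
        (by rw [hθm] at he; have he' : a₂ * x + a₁ * y = k := by exact_mod_cast he
            linear_combination he' - k * hb)
      push_cast at hx hy
      rw [ex, mul_pos_iff_of_pos_left ha₁'] at hx
      rw [ey, mul_pos_iff_of_pos_left ha₂'] at hy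
      exact ⟨j, ⟨by linarith, by linarith⟩, rfl, rfl⟩
    · rintro ⟨j, ⟨hl, hr⟩, rfl, rfl⟩
      push_cast
      rw [ex, ey, mul_pos_iff_of_pos_left ha₁', mul_pos_iff_of_pos_left ha₂',
        mul_lt_mul_iff_right₀ ha₁', mul_lt_mul_iff_right₀ ha₂']
      exact ⟨by linear_combination k * hb' - hθm, ⟨by linarith, by linarith⟩,
        by linarith, by linarith⟩
  have hminus : (Mcount (a₁ * n + m₁) m₂ m₁ (a₂ * n + m₂) (θ + 1) : ℝ)
      = ⌈α + n⌉ - ⌊-β⌋ - 1 := by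
    refine Mcount_eq_of_forall_iff (a₁ := a₁) (a₂ := a₂) (x₀ := m₁ + b₁ * k)
      (y₀ := m₂ + n * a₂ + b₂ * k) ha₁.ne' (by linarith) fun x y => ?_
    rw [mem_para_and_uFun_eq_iff ha₁ ha₂ hn hm hm0]
    have ex (j : ℝ) : m₁ + b₁ * k + a₁ * j - (θ + 1) * m₁ = a₁ * (j - α) := by
      linear_combination hα'
    have ey (j : ℝ) : m₂ + n * a₂ + b₂ * k - a₂ * j - (θ + 1) * m₂ = a₂ * (n - j - β) := by
      linear_combination hβ'
    constructor
    · rintro ⟨he, ⟨-, hx⟩, -, hy⟩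
      obtain ⟨j, rfl, rfl⟩ := exists_eq_add_mul_of_linear_eq (x := x) (y := y) (x₀ := m₁ + b₁ * k)
        (y₀ := m₂ + n * a₂ + b₂ * k) hb
        (by rw [add_mul, hθm, one_mul] at he
            have he' : a₂ * x + a₁ * y = k + m := by exact_mod_cast he
            linear_combination he' - k * hb + hm)
      push_cast at hx hy
      rw [ex, mul_lt_mul_iff_right₀ ha₁'] at hx
      rw [ey, mul_lt_mul_iff_right₀ ha₂'] at hy
      exact ⟨j, ⟨by linarith, by linarith⟩, rfl, rfl⟩
    · rintro ⟨j, ⟨hl, hr⟩, rfl, rfl⟩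
      push_cast
      rw [ex, ey, mul_pos_iff_of_pos_left ha₁', mul_pos_iff_of_pos_left ha₂',
        mul_lt_mul_iff_right₀ ha₁', mul_lt_mul_iff_right₀ ha₂']
      exact ⟨by linear_combination k * hb' - hθm - hm', ⟨by linarith, by linarith⟩,
        by linarith, by linarith⟩
  have hfl : ⌊θ⌋ = 0 := Int.floor_eq_zero_iff.2 ⟨hθ0.le, hθ1⟩
  have hce : ⌈θ⌉ = 1 := by
    rw [Int.ceil_eq_iff]
    norm_num
    exact ⟨hθ0, hθ1.le⟩
  have hsα := neg_two_mul_saw α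
  have hsβ := neg_two_mul_saw β
  have hsθ := neg_two_mul_saw θ
  rw [hfl, hce] at hsθ
  rw [hplus, hminus, Int.ceil_neg, Int.floor_neg, Int.ceil_add_intCast]
  push_cast at hsθ ⊢
  linear_combination hsα + hsβ + n * hsθ + 2 * hαβ
end

section
/- Assume the Seifert data. Let k be an integer with 0 < k < m and set θ = k/m. Then, in the parallelogram Π(a,b,c,d) with (a,b) = (a₁n + m₁, m₂) and (c,d) = (m₁, a₂n + m₂), one has M_θ⁺ + M_θ⁻ + ε(θ·(a,b)) + ε(θ·(c,d)) = n, where for a point P ∈ ℝ² we set ε(P) = 1 if P ∈ ℤ² and ε(P) = 0 otherwise. -/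
open scoped Classical

/-- `latticePt P` means the point `P ∈ ℝ²` has integer coordinates. -/
def latticePt (P : ℝ × ℝ) : Prop :=
  (∃ x : ℤ, (x : ℝ) = P.1) ∧ (∃ y : ℤ, (y : ℝ) = P.2)

theorem mem_para_iff {a b c d : ℤ} (hD : 0 < a * d - b * c) (x y : ℤ) :
    ((x : ℝ), (y : ℝ)) ∈ para a b c d ↔
      (0 < d * x - c * y ∧ d * x - c * y < a * d - b * c) ∧
        0 < a * y - b * x ∧ a * y - b * x < a * d - b * c := by
  have hD' : (0 : ℝ) < a * d - b * c := by exact_mod_cast hD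
  constructor
  · rintro ⟨s, t, hs0, hs1, ht0, ht1, hP⟩
    obtain ⟨hx, hy⟩ := Prod.mk.inj hP
    have hs : (d * x - c * y : ℝ) = s * (a * d - b * c) := by rw [hx, hy]; ring
    have ht : (a * y - b * x : ℝ) = t * (a * d - b * c) := by rw [hx, hy]; ring
    refine ⟨⟨?_, ?_⟩, ?_, ?_⟩ <;> rify
    · rw [hs]; positivity
    · rw [hs]; nlinarith
    · rw [ht]; positivity
    · rw [ht]; nlinarith
  · rintro ⟨⟨h1, h2⟩, h3, h4⟩
    rify at h1 h2 h3 h4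
    refine ⟨(d * x - c * y) / (a * d - b * c), (a * y - b * x) / (a * d - b * c),
      div_pos h1 hD', (div_lt_one hD').2 h2, div_pos h3 hD', (div_lt_one hD').2 h4, ?_⟩
    ext <;> dsimp only <;>
      rw [div_mul_eq_mul_div, div_mul_eq_mul_div, ← add_div, eq_div_iff hD'.ne'] <;> ring

theorem uFun_eq_div_iff {a₁ a₂ n m₁ m₂ m : ℤ} (hn : 0 < n) (hm0 : 0 < m)
    (hm : m = m₁ * a₂ + m₂ * a₁ + n * (a₁ * a₂)) (K x y : ℤ) :
    uFun (a₁ * n + m₁) m₂ m₁ (a₂ * n + m₂) ((x : ℝ), (y : ℝ)) = (K : ℝ) / m ↔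
      a₂ * x + a₁ * y = K := by
  have hn' : (n : ℝ) ≠ 0 := by exact_mod_cast hn.ne'
  have hm' : (m : ℝ) ≠ 0 := by exact_mod_cast hm0.ne'
  have hu : uFun (a₁ * n + m₁) m₂ m₁ (a₂ * n + m₂) ((x : ℝ), (y : ℝ)) =
      ((a₂ * x + a₁ * y : ℤ) : ℝ) / m := by
    have hD : (((a₁ * n + m₁ : ℤ) : ℝ) * ((a₂ * n + m₂ : ℤ) : ℝ) - m₂ * m₁) = n * m := by
      rw [hm]; push_cast; ring
    rw [uFun, hD]
    push_cast
    field_simp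
    ring
  rw [hu, div_left_inj' hm', Int.cast_inj]

theorem latticePt_div_mul_iff {m : ℤ} (hm0 : 0 < m) (k p q : ℤ) :
    latticePt ((k : ℝ) / m * p, (k : ℝ) / m * q) ↔
      (∃ x : ℤ, m * x = k * p) ∧ ∃ y : ℤ, m * y = k * q := by
  have hm' : (m : ℝ) ≠ 0 := by exact_mod_cast hm0.ne'
  have h (z r : ℤ) : (z : ℝ) = (k : ℝ) / m * r ↔ m * z = k * r := by
    rw [div_mul_eq_mul_div, eq_div_iff hm', mul_comm (z : ℝ)]
    exact_mod_cast Iff.rfl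
  simp only [latticePt, h]

/-- Each value of `d * x - c * y` is attained at most once on the line `a₂ * x + a₁ * y = k`,
at the real point `((a₁ * v + c * k) / m, (d * k - a₂ * v) / m)`. -/
theorem exists_lattice_point_iff {a₁ a₂ b₁ b₂ c d m : ℤ}
    (hb : a₁ * b₂ + a₂ * b₁ = 1) (hm : m = d * a₁ + c * a₂) (k v : ℤ) :
    ((∃ x : ℤ, m * x = a₁ * v + c * k) ∧ ∃ y : ℤ, m * y = d * k - a₂ * v) ↔
      ∃ j : ℤ, (d * b₁ - c * b₂) * k + j * m = v := by
  constructor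
  · rintro ⟨⟨x, hx⟩, y, hy⟩
    refine ⟨b₂ * x - b₁ * y, ?_⟩
    linear_combination b₂ * hx - b₁ * hy + v * hb
  · rintro ⟨j, rfl⟩
    refine ⟨⟨b₁ * k + a₁ * j, ?_⟩, b₂ * k - a₂ * j, ?_⟩
    · linear_combination b₁ * k * hm + c * k * hb
    · linear_combination b₂ * k * hm + d * k * hb

theorem Mcount_eq_card {a₁ a₂ n m₁ m₂ b₁ b₂ m : ℤ} (ha₁ : 0 < a₁) (hn : 0 < n) (hm0 : 0 < m)
    (hb : a₁ * b₂ + a₂ * b₁ = 1) (hm : m = m₁ * a₂ + m₂ * a₁ + n * (a₁ * a₂))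
    (K e : ℤ) (S : Finset ℤ)
    (hS : ∀ j, j ∈ S ↔
      (0 < ((a₂ * n + m₂) * b₁ - m₁ * b₂) * K + (j - e) * m ∧
        ((a₂ * n + m₂) * b₁ - m₁ * b₂) * K + (j - e) * m < n * m) ∧
      0 < n * K - (((a₂ * n + m₂) * b₁ - m₁ * b₂) * K + (j - e) * m) ∧
        n * K - (((a₂ * n + m₂) * b₁ - m₁ * b₂) * K + (j - e) * m) < n * m) :
    Mcount (a₁ * n + m₁) m₂ m₁ (a₂ * n + m₂) ((K : ℝ) / m) = S.card := by
  have hD : (a₁ * n + m₁) * (a₂ * n + m₂) - m₂ * m₁ = n * m := by rw [hm]; ring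
  have hD0 : 0 < (a₁ * n + m₁) * (a₂ * n + m₂) - m₂ * m₁ := by rw [hD]; positivity
  let φ : ℤ → ℤ × ℤ := fun j => (b₁ * K + a₁ * (j - e), b₂ * K - a₂ * (j - e))
  have hφ : Function.Injective φ := by
    intro i j hij
    have h := (Prod.mk.inj hij).1
    have h' : a₁ * i = a₁ * j := by linarith
    exact mul_left_cancel₀ ha₁.ne' h'
  rw [Mcount, ← Set.ncard_coe_finset S, ← Set.ncard_image_of_injective _ hφ]
  congr 1
  ext ⟨x, y⟩
  simp only [Set.mem_ofPred_eq, Set.mem_image, Finset.mem_coe, mem_para_iff hD0,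
    uFun_eq_div_iff hn hm0 hm, hD, hS]
  have key (j : ℤ) : (a₂ * n + m₂) * (b₁ * K + a₁ * (j - e)) - m₁ * (b₂ * K - a₂ * (j - e)) =
      ((a₂ * n + m₂) * b₁ - m₁ * b₂) * K + (j - e) * m := by rw [hm]; ring
  have key' (j : ℤ) : (a₁ * n + m₁) * (b₂ * K - a₂ * (j - e)) - m₂ * (b₁ * K + a₁ * (j - e)) =
      n * K - (((a₂ * n + m₂) * b₁ - m₁ * b₂) * K + (j - e) * m) := by
    rw [hm]; linear_combination n * K * hb
  constructor
  · rintro ⟨h, hK⟩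
    have hx : x = b₁ * K + a₁ * (b₂ * x - b₁ * y + e - e) := by
      linear_combination -x * hb + b₁ * hK
    have hy : y = b₂ * K - a₂ * (b₂ * x - b₁ * y + e - e) := by
      linear_combination -y * hb + b₂ * hK
    refine ⟨b₂ * x - b₁ * y + e, ?_, Prod.ext hx.symm hy.symm⟩
    rw [← key', ← key, ← hx, ← hy]
    exact h
  · rintro ⟨j, h, hj⟩
    obtain ⟨rfl, rfl⟩ := Prod.mk.inj hj
    rw [key, key']
    exact ⟨h, by linear_combination K * hb⟩

theorem card_filter_affine_eq {m f v : ℤ} (hm0 : 0 < m) (S : Finset ℤ)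
    (hS : ∀ j, f + j * m = v → j ∈ S) :
    (S.filter fun j => f + j * m = v).card = if ∃ j, f + j * m = v then 1 else 0 := by
  split_ifs with h
  · obtain ⟨i, hi⟩ := h
    rw [Finset.card_eq_one]
    refine ⟨i, Finset.ext fun j => ?_⟩
    rw [Finset.mem_filter, Finset.mem_singleton]
    constructor
    · rintro ⟨-, hj⟩
      have h' : j * m = i * m := by linarith
      exact mul_right_cancel₀ hm0.ne' h'
    · rintro rfl
      exact ⟨hS _ hi, hi⟩
  · rw [Finset.card_eq_zero, Finset.filter_eq_empty_iff]
    exact fun j _ hj => h ⟨j, hj⟩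

theorem mem_Ico_neg_ediv_iff {m : ℤ} (hm0 : 0 < m) (f n j : ℤ) :
    j ∈ Finset.Ico (-(f / m)) (n - f / m) ↔ 0 ≤ f + j * m ∧ f + j * m < n * m := by
  have h1 : 0 ≤ f + j * m ↔ 0 ≤ (f + j * m) / m := (Int.ediv_nonneg_iff_of_pos hm0).symm
  have h2 : f + j * m < n * m ↔ (f + j * m) / m < n := (Int.ediv_lt_iff_lt_mul hm0).symm
  rw [h1, h2, Int.add_mul_ediv_right _ _ hm0.ne', Finset.mem_Ico]
  omega

theorem card_filter_trichotomy {S : Finset ℤ} {g : ℤ → ℤ} {w : ℤ} (hw : 0 < w)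
    (hS : ∀ j ∈ S, 0 ≤ g j) :
    (S.filter fun j => 0 < g j ∧ g j < w).card + (S.filter fun j => w < g j).card +
      (S.filter fun j => g j = w).card + (S.filter fun j => g j = 0).card = S.card := by
  simp only [Finset.card_filter, ← Finset.sum_add_distrib]
  rw [Finset.card_eq_sum_ones]
  refine Finset.sum_congr rfl fun j hj => ?_
  have := hS j hj
  split_ifs <;> omega

theorem M_plus_add_M_minus_add_boundary_eq_n
    (a₁ a₂ n m₁ m₂ b₁ b₂ m : ℤ) (s₁ s₂ : ℚ)
    (ha₁ : 0 < a₁) (ha₂ : 0 < a₂) (hcop : IsCoprime a₁ a₂) (hn : 0 < n)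
    (hm₁ : m₁ = 0 ∨ m₁ = 1) (hm₂ : m₂ = 0 ∨ m₂ = 1)
    (hb : a₁ * b₂ + a₂ * b₁ = 1)
    (hm : m = m₁ * a₂ + m₂ * a₁ + n * (a₁ * a₂))
    (hs₁ : s₁ = ((m₁ : ℚ) - b₁ * m) / a₁) (hs₂ : s₂ = ((m₂ : ℚ) - b₂ * m) / a₂)
    (k : ℤ) (hk0 : 0 < k) (hkm : k < m) :
    (Mcount (a₁ * n + m₁) m₂ m₁ (a₂ * n + m₂) ((k : ℝ) / (m : ℝ)) : ℤ)
      + (Mcount (a₁ * n + m₁) m₂ m₁ (a₂ * n + m₂) ((k : ℝ) / (m : ℝ) + 1) : ℤ)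
      + (if latticePt (((k : ℝ) / (m : ℝ)) * ((a₁ * n + m₁ : ℤ) : ℝ),
            ((k : ℝ) / (m : ℝ)) * ((m₂ : ℤ) : ℝ)) then 1 else 0)
      + (if latticePt (((k : ℝ) / (m : ℝ)) * ((m₁ : ℤ) : ℝ),
            ((k : ℝ) / (m : ℝ)) * ((a₂ * n + m₂ : ℤ) : ℝ)) then 1 else 0) = n := by
  have hm0 : 0 < m := hk0.trans hkm
  have hnk : 0 < n * k := by positivity
  have hnkm : n * k < n * m := by gcongr
  have hm' : (m : ℝ) ≠ 0 := by exact_mod_cast hm0.ne'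
  have hmd : m = (a₂ * n + m₂) * a₁ + m₁ * a₂ := by rw [hm]; ring
  set e := (a₂ * n + m₂) * b₁ - m₁ * b₂ with he
  set S := Finset.Ico (-(e * k / m)) (n - e * k / m) with hS
  have hmem (j : ℤ) : j ∈ S ↔ 0 ≤ e * k + j * m ∧ e * k + j * m < n * m :=
    mem_Ico_neg_ediv_iff hm0 _ _ _
  have hcard : (S.card : ℤ) = n := by
    rw [hS, Int.card_Ico, Int.toNat_of_nonneg] <;> omega
  have hplus : Mcount (a₁ * n + m₁) m₂ m₁ (a₂ * n + m₂) ((k : ℝ) / (m : ℝ)) =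
      (S.filter fun j => 0 < e * k + j * m ∧ e * k + j * m < n * k).card := by
    refine Mcount_eq_card ha₁ hn hm0 hb hm k 0 _ fun j => ?_
    rw [Finset.mem_filter, hmem, ← he, sub_zero]
    omega
  have hminus : Mcount (a₁ * n + m₁) m₂ m₁ (a₂ * n + m₂) ((k : ℝ) / (m : ℝ) + 1) =
      (S.filter fun j => n * k < e * k + j * m).card := by
    have hθ : (k : ℝ) / (m : ℝ) + 1 = ((k + m : ℤ) : ℝ) / m := by
      push_cast
      field_simp
    rw [hθ]
    refine Mcount_eq_card ha₁ hn hm0 hb hm (k + m) e _ fun j => ?_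
    have h1 : e * (k + m) + (j - e) * m = e * k + j * m := by ring
    rw [Finset.mem_filter, hmem, ← he, h1, mul_add]
    omega
  have hε₁ : latticePt (((k : ℝ) / (m : ℝ)) * ((a₁ * n + m₁ : ℤ) : ℝ),
      ((k : ℝ) / (m : ℝ)) * ((m₂ : ℤ) : ℝ)) ↔ ∃ j, e * k + j * m = n * k := by
    rw [latticePt_div_mul_iff hm0, he, ← exists_lattice_point_iff hb hmd]
    ring_nf
  have hε₂ : latticePt (((k : ℝ) / (m : ℝ)) * ((m₁ : ℤ) : ℝ),
      ((k : ℝ) / (m : ℝ)) * ((a₂ * n + m₂ : ℤ) : ℝ)) ↔ ∃ j, e * k + j * m = 0 := by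
    rw [latticePt_div_mul_iff hm0, he, ← exists_lattice_point_iff hb hmd]
    ring_nf
  have h₁ := card_filter_affine_eq (f := e * k) (v := n * k) hm0 S
    fun j hj => (hmem j).2 (by omega)
  have h₂ := card_filter_affine_eq (f := e * k) (v := 0) hm0 S
    fun j hj => (hmem j).2 (by omega)
  have htotal := card_filter_trichotomy (S := S) (g := fun j => e * k + j * m) hnk
    fun j hj => ((hmem j).1 hj).1
  beta_reduce at htotal
  rw [h₁, h₂] at htotal
  refine Eq.trans ?_ hcard
  rw [hplus, hminus, ← htotal]
  simp only [hε₁, hε₂]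
  push_cast
  rfl
end

section
/- Let p and q be positive integers and m₁, m₂ ∈ {0,1}, and set (a,b) = (p + m₁, m₂) and (c,d) = (m₁, q + m₂), so that ad − bc > 0. Then the number of lattice points (x,y) ∈ ℤ² lying in the open parallelogram Π(a,b,c,d) and satisfying u(x,y) = 1 equals gcd(p,q) − 1. -/
open scoped Classical

/-- A lattice point lies in the open parallelogram on the line `u = 1` exactly when it lies strictly
between `(p + m₁, m₂)` and `(m₁, q + m₂)` on the segment joining them. -/
lemma mem_para_and_uFun_eq_one_iff {p q m₁ m₂ : ℤ} (hp : 0 < p) (hq : 0 < q)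
    (hm₁ : 0 ≤ m₁) (hm₂ : 0 ≤ m₂) (x y : ℤ) :
    (((x : ℝ), (y : ℝ)) ∈ para (p + m₁) m₂ m₁ (q + m₂) ∧
      uFun (p + m₁) m₂ m₁ (q + m₂) ((x : ℝ), (y : ℝ)) = 1) ↔
    q * (x - m₁) + p * (y - m₂) = p * q ∧ 0 < x - m₁ ∧ x - m₁ < p := by
  have hpR : (0 : ℝ) < p := by exact_mod_cast hp
  have hqR : (0 : ℝ) < q := by exact_mod_cast hq
  have h₁ : (0 : ℝ) ≤ m₁ := by exact_mod_cast hm₁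
  have h₂ : (0 : ℝ) ≤ m₂ := by exact_mod_cast hm₂
  have hD : (0 : ℝ) < ((p : ℝ) + m₁) * (q + m₂) - m₂ * m₁ := by
    have : ((p : ℝ) + m₁) * (q + m₂) - m₂ * m₁ = p * q + p * m₂ + m₁ * q := by ring
    rw [this]
    positivity
  have hu : uFun (p + m₁) m₂ m₁ (q + m₂) ((x : ℝ), (y : ℝ)) = 1 ↔
      (q : ℝ) * (x - m₁) + p * (y - m₂) = p * q := by
    simp only [uFun]
    push_cast
    rw [div_eq_one_iff_eq hD.ne']
    constructor <;> intro h <;> linarith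
  have hcast : (q : ℝ) * (x - m₁) + p * (y - m₂) = p * q ↔
      q * (x - m₁) + p * (y - m₂) = p * q := by norm_cast
  rw [hu, ← hcast]
  constructor
  · rintro ⟨⟨s, t, hs, hs1, -, -, hP⟩, h⟩
    simp only [Prod.mk.injEq] at hP
    push_cast at hP
    obtain ⟨hx, hy⟩ := hP
    have hst : s + t = 1 := by
      apply mul_left_cancel₀ hD.ne'
      rw [hx, hy] at h
      linear_combination h
    have hxs : (x : ℝ) - m₁ = s * p := by linear_combination hx + m₁ * hst
    refine ⟨h, ?_, ?_⟩
    · have : (0 : ℝ) < x - m₁ := by rw [hxs]; positivity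
      exact_mod_cast this
    · have : (x : ℝ) - m₁ < p := by rw [hxs]; exact mul_lt_of_lt_one_left hpR hs1
      exact_mod_cast this
  · rintro ⟨h, hx0, hxp⟩
    have hx0R : (0 : ℝ) < x - m₁ := by exact_mod_cast hx0
    have hxpR : (x : ℝ) - m₁ < p := by exact_mod_cast hxp
    have hs : 0 < ((x : ℝ) - m₁) / p := div_pos hx0R hpR
    have hs1 : ((x : ℝ) - m₁) / p < 1 := (div_lt_one hpR).2 hxpR
    refine ⟨⟨((x : ℝ) - m₁) / p, 1 - ((x : ℝ) - m₁) / p, hs, hs1, by linarith, by linarith, ?_⟩, h⟩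
    simp only [Prod.mk.injEq]
    push_cast
    constructor
    · field_simp
      ring
    · field_simp
      linear_combination h

/-- The interior lattice points of the segment from `(0, g * b)` to `(g * a, 0)`, for coprime `a`
and `b`, are the points `(a * k, b * (g - k))` with `0 < k < g`. -/
lemma lattice_point_on_segment_iff {a b g : ℤ} (ha : 0 < a) (hab : IsCoprime a b)
    (hg : 0 < g) (X Y : ℤ) :
    (g * b * X + g * a * Y = g * a * (g * b) ∧ 0 < X ∧ X < g * a) ↔
      ∃ k, (0 < k ∧ k < g) ∧ a * k = X ∧ b * (g - k) = Y := by
  constructor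
  · rintro ⟨h, hX0, hX⟩
    have h' : b * X + a * Y = a * (g * b) := by
      apply mul_left_cancel₀ hg.ne'
      linear_combination h
    obtain ⟨k, rfl⟩ : a ∣ X := hab.dvd_of_dvd_mul_left ⟨g * b - Y, by linear_combination h'⟩
    refine ⟨k, ⟨pos_of_mul_pos_right hX0 ha.le, ?_⟩, rfl, ?_⟩
    · exact lt_of_mul_lt_mul_left (by linarith) ha.le
    · apply mul_left_cancel₀ ha.ne'
      linear_combination -h'
  · rintro ⟨k, ⟨hk0, hkg⟩, rfl, rfl⟩
    exact ⟨by ring, mul_pos ha hk0, by nlinarith⟩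

theorem lattice_points_on_middle_line_eq_gcd_sub_one
    (p q m₁ m₂ : ℤ) (hp : 0 < p) (hq : 0 < q)
    (hm₁ : m₁ = 0 ∨ m₁ = 1) (hm₂ : m₂ = 0 ∨ m₂ = 1) :
    (Mcount (p + m₁) m₂ m₁ (q + m₂) 1 : ℤ) = (Int.gcd p q : ℤ) - 1 := by
  have hg : (0 : ℤ) < Int.gcd p q := by exact_mod_cast Int.gcd_pos_of_ne_zero_left q hp.ne'
  obtain ⟨a, ha⟩ := Int.gcd_dvd_left p q
  obtain ⟨b, hb⟩ := Int.gcd_dvd_right p q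
  have hab : IsCoprime a b := by
    refine ⟨Int.gcdA p q, Int.gcdB p q, mul_left_cancel₀ hg.ne' ?_⟩
    linear_combination -Int.gcd_eq_gcd_ab p q - Int.gcdA p q * ha - Int.gcdB p q * hb
  generalize (Int.gcd p q : ℤ) = g at *
  subst ha hb
  have ha0 : 0 < a := pos_of_mul_pos_right hp hg.le
  have hset : {P : ℤ × ℤ | ((P.1 : ℝ), (P.2 : ℝ)) ∈ para (g * a + m₁) m₂ m₁ (g * b + m₂) ∧
      uFun (g * a + m₁) m₂ m₁ (g * b + m₂) ((P.1 : ℝ), (P.2 : ℝ)) = 1} =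
      (fun k : ℤ => (m₁ + a * k, m₂ + b * (g - k))) '' (Finset.Ioo 0 g : Finset ℤ) := by
    ext ⟨x, y⟩
    simp only [Set.mem_ofPred_eq, Set.mem_image, Finset.coe_Ioo, Set.mem_Ioo, Prod.mk.injEq]
    rw [mem_para_and_uFun_eq_one_iff hp hq (by omega) (by omega),
      lattice_point_on_segment_iff ha0 hab hg]
    simp only [eq_sub_iff_add_eq']
  have hinj : Function.Injective fun k : ℤ => (m₁ + a * k, m₂ + b * (g - k)) := by
    intro k l hkl
    exact mul_left_cancel₀ ha0.ne' (add_left_cancel (Prod.mk.inj hkl).1)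
  rw [Mcount, hset, Set.ncard_image_of_injective _ hinj, Set.ncard_coe_finset, Int.card_Ioo]
  omega
end
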